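/- Let q = p^h, let U ⊆ GF(q)^2 be nonempty with Rédei polynomial R(X,Y), and define Q(X,Y), H(X,Y) by R(X,Y)·Q(X,Y) = X^q + H(X,Y) with deg_X H < deg_X R. Suppose 2|U| ≤ q (so that deg_X R ≤ deg_X Q). If y ∈ GF(q) is a determined direction (y ∈ D), then Q(X,y) ∉ GF(q)[X^{p·s(y)}]. -/

import Mathlib

open Polynomial
open scoped Classical

noncomputable section

/-- The direction determined by two points of `AG(2,q) = F × F`; `none` denotes the
vertical direction `∞`, and `some m` denotes the slope `m = (b-d)/(a-c)`. -/
def direction {F : Type*} [Field F] (P Q : F × F) : Option F :=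
  if P.1 = Q.1 then none else some ((P.2 - Q.2) / (P.1 - Q.1))

/-- The set of directions determined by a set `U` of affine points. -/
def dirSet {F : Type*} [Field F] (U : Set (F × F)) : Set (Option F) :=
  {d | ∃ P ∈ U, ∃ Q ∈ U, P ≠ Q ∧ direction P Q = d}

/-- Membership in the affine line with direction `y` and parameter `c`:
for `y = some m` the line `{(u,w) | w = m·u + c}`, for `y = none` the vertical line
`{(u,w) | u = c}`. -/
def onLine {F : Type*} [Field F] (y : Option F) (c : F) (P : F × F) : Prop :=
  match y with
  | none => P.1 = c
  | some m => P.2 = m * P.1 + c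

/-- The number of points of `U` on the affine line with direction `y` and parameter `c`. -/
def lineCount {F : Type*} [Field F] (U : Set (F × F)) (y : Option F) (c : F) : ℕ :=
  {P ∈ U | onLine y c P}.ncard

/-- `s(y)`: the gcd of the intersection sizes of `U` with the lines of direction `y`,
together with `q`. -/
def sdir {F : Type*} [Field F] [Fintype F] (U : Set (F × F)) (y : Option F) : ℕ :=
  Nat.gcd (Fintype.card F) (Finset.univ.gcd fun c : F => lineCount U y c)

/-- `s`: the minimum of `s(y)` over the determined directions. -/
def sMin {F : Type*} [Field F] [Fintype F] (U : Set (F × F)) : ℕ :=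
  sInf (sdir U '' dirSet U)

/-- The Rédei polynomial `R(X,Y) = ∏_{(a,b)∈U} (X - aY + b)`, as a polynomial in `X`
with coefficients in `GF(q)[Y]`. -/
def redei {F : Type*} [Field F] (U : Finset (F × F)) : Polynomial (Polynomial F) :=
  ∏ P ∈ U, (X - C (C P.1 * X - C P.2))

/-- The quotient `Q(X,Y)` of `X^q - X` upon Euclidean division (in `X`) by the
(monic in `X`) Rédei polynomial. -/
def Qpoly {F : Type*} [Field F] [Fintype F] (U : Finset (F × F)) : Polynomial (Polynomial F) :=
  (X ^ Fintype.card F - X) /ₘ redei U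

/-- `H(X,Y)`, defined by `-X - H(X,Y) = (X^q - X) mod R(X,Y)`, so that
`R·Q = X^q + H` with `deg_X H < deg_X R`. -/
def Hpoly {F : Type*} [Field F] [Fintype F] (U : Finset (F × F)) : Polynomial (Polynomial F) :=
  -X - (X ^ Fintype.card F - X) %ₘ redei U

/-- The evaluation `R(X,y)` of the Rédei polynomial at `Y = y`. -/
def redeiAt {F : Type*} [Field F] (U : Finset (F × F)) (y : F) : Polynomial F :=
  (redei U).map (evalRingHom y)

/-- The evaluation `Q(X,y)`. -/
def QAt {F : Type*} [Field F] [Fintype F] (U : Finset (F × F)) (y : F) : Polynomial F :=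
  (Qpoly U).map (evalRingHom y)

/-- The evaluation `H(X,y)`. -/
def HAt {F : Type*} [Field F] [Fintype F] (U : Finset (F × F)) (y : F) : Polynomial F :=
  (Hpoly U).map (evalRingHom y)

/-- `g ∈ R[X^r]`: every power of `X` occurring in `g` with nonzero coefficient has
exponent divisible by `r`. -/
def inXpow {R : Type*} [Semiring R] (r : ℕ) (g : Polynomial R) : Prop :=
  ∀ i : ℕ, g.coeff i ≠ 0 → r ∣ i

lemma aux_expand {F : Type*} [Field F] [Fintype F] (p e : ℕ) [Fact p.Prime] [CharP F p]
    (g : F[X]) : ∃ G, g ^ p ^ e = expand F (p ^ e) G :=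
  ⟨g.map (iterateFrobenius F p e), by
    rw [← map_expand, map_iterateFrobenius_expand]⟩

lemma aux_pow {F : Type*} [Field F] [Fintype F] (p e : ℕ) [Fact p.Prime] [CharP F p]
    (G : F[X]) : ∃ T : F[X], expand F (p ^ e) G = T ^ p ^ e := by
  obtain ⟨T, rfl⟩ := Polynomial.map_surjective (iterateFrobenius F p e)
    (bijective_iterateFrobenius F p e).surjective G
  exact ⟨T, by rw [← map_expand, map_iterateFrobenius_expand]⟩

lemma redeiAt_eq {F : Type*} [Field F] (U : Finset (F × F)) (y : F) :
    redeiAt U y = ∏ P ∈ U, (X - C (P.1 * y - P.2)) := by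
  simp [redeiAt, redei, Polynomial.map_prod]

lemma lineCount_eq {F : Type*} [Field F] (U : Finset (F × F)) (y c : F) :
    lineCount (↑U : Set (F × F)) (some y) c = (U.filter fun P => P.1 * y - P.2 = -c).card := by
  rw [lineCount, ← Set.ncard_coe_finset]
  congr 1
  ext P
  simp only [onLine, Set.mem_ofPred_eq, Finset.coe_filter, Finset.mem_coe]
  refine and_congr_right fun _ => ⟨fun h => by rw [h]; ring, fun h => by linear_combination -h⟩

lemma redeiAt_prod {F : Type*} [Field F] [Fintype F] (U : Finset (F × F)) (y : F) :
    redeiAt U y = ∏ c : F, (X + C c) ^ lineCount (↑U : Set (F × F)) (some y) c := by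
  rw [redeiAt_eq, ← Finset.prod_fiberwise U (fun P => -(P.1 * y - P.2))]
  refine Finset.prod_congr rfl fun c _ => ?_
  rw [lineCount_eq, ← Finset.prod_const]
  refine Finset.prod_congr ?_ ?_
  · ext P
    simp only [Finset.mem_filter, neg_eq_iff_eq_neg]
  · intro P hP
    rw [(Finset.mem_filter.1 hP).2]
    simp

lemma redeiAt_rootMult {F : Type*} [Field F] [Fintype F] (U : Finset (F × F)) (y c : F) :
    (redeiAt U y).rootMultiplicity (-c) = lineCount (↑U : Set (F × F)) (some y) c := by
  rw [lineCount_eq, redeiAt_eq, ← count_roots]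
  have : (∏ P ∈ U, (X - C (P.1 * y - P.2))) =
      ((U.val.map fun P => P.1 * y - P.2).map fun a => X - C a).prod := by
    rw [Multiset.map_map]; rfl
  rw [this, roots_multiset_prod_X_sub_C, Multiset.count_map, Finset.card_def, Finset.filter_val]
  simp only [eq_comm]

lemma redeiAt_monic {F : Type*} [Field F] (U : Finset (F × F)) (y : F) :
    (redeiAt U y).Monic := by
  rw [redeiAt_eq]; exact monic_prod_of_monic _ _ fun P _ => monic_X_sub_C _

lemma redeiAt_natDegree {F : Type*} [Field F] (U : Finset (F × F)) (y : F) :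
    (redeiAt U y).natDegree = U.card := by
  rw [redeiAt_eq, natDegree_prod_of_monic _ _ fun P _ => monic_X_sub_C _]
  simp only [natDegree_X_sub_C, Finset.sum_const, smul_eq_mul, mul_one]

lemma QAt_eq {F : Type*} [Field F] [Fintype F] (U : Finset (F × F)) (y : F) :
    QAt U y = (X ^ Fintype.card F - X) /ₘ redeiAt U y := by
  have : (redei U).Monic := monic_prod_of_monic _ _ fun P _ => monic_X_sub_C _
  rw [QAt, Qpoly, map_divByMonic _ this, redeiAt]; simp

lemma aux_sdir_dvd {F : Type*} [Field F] [Fintype F] (U : Set (F × F)) (y : Option F) (k : ℕ) :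
    k ∣ sdir U y ↔ k ∣ Fintype.card F ∧ ∀ c, k ∣ lineCount U y c := by
  simp [sdir, Nat.dvd_gcd_iff, Finset.dvd_gcd_iff]

/-- For a nonempty `U ⊆ AG(2,q)` with `2|U| ≤ q` (so that
`deg_X R ≤ deg_X Q`) and a determined direction `y ∈ D ∩ GF(q)`, the quotient
satisfies `Q(X,y) ∉ GF(q)[X^{p·s(y)}]`. -/
theorem Q_not_in_higher_power_at_determined_direction
    {F : Type*} [Field F] [Fintype F] (p h : ℕ) (hp : p.Prime) (hh : 0 < h)
    (hcard : Fintype.card F = p ^ h) (U : Finset (F × F)) (hU : U.Nonempty)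
    (hsize : 2 * U.card ≤ Fintype.card F)
    (y : F) (hy : some y ∈ dirSet (↑U : Set (F × F))) :
    ¬ inXpow (p * sdir (↑U : Set (F × F)) (some y)) (QAt U y) := by
  intro hQ
  have := Fact.mk hp
  have : CharP F p := charP_of_card_eq_prime_pow (f := h) (by simpa using hcard)
  have h2 : 1 < U.card := by
    obtain ⟨P, hP, Q, hQ, hne, -⟩ := hy
    exact Finset.one_lt_card.2 ⟨P, hP, Q, hQ, hne⟩
  obtain ⟨hs1, hs2⟩ := (aux_sdir_dvd (↑U : Set (F × F)) (some y) _).1 dvd_rfl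
  have hsn : sdir (↑U : Set (F × F)) (some y) ∣ U.card := by
    rw [← redeiAt_natDegree U y, redeiAt_prod,
      natDegree_prod_of_monic _ _ fun c _ => (monic_X_add_C c).pow _]
    refine Finset.dvd_sum fun c _ => ?_
    simpa using hs2 c
  have hsmax : ¬ (p * sdir (↑U : Set (F × F)) (some y)) ∣ sdir (↑U : Set (F × F)) (some y) := by
    have hpos : 0 < sdir (↑U : Set (F × F)) (some y) := Nat.pos_of_dvd_of_pos hsn (by omega)
    intro hd
    have := Nat.le_of_dvd hpos hd
    have := hp.two_le
    nlinarith
  rw [aux_sdir_dvd] at hsmax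
  generalize sdir (↑U : Set (F × F)) (some y) = s at *
  obtain ⟨e, he, rfl⟩ := (Nat.dvd_prime_pow hp).1 (hcard ▸ hs1)
  have heh : e < h := by
    refine lt_of_le_of_ne he ?_
    rintro rfl
    have := Nat.le_of_dvd (by omega) hsn
    omega
  rw [← pow_succ'] at hsmax
  apply hsmax
  refine ⟨hcard ▸ pow_dvd_pow p heh, ?_⟩
  -- write r as an expansion
  obtain ⟨G, hG⟩ : ∃ G, redeiAt U y = expand F (p ^ e) G := by
    obtain ⟨G, hG⟩ := aux_expand p e
      (∏ c : F, (X + C c) ^ (lineCount (↑U : Set (F × F)) (some y) c / p ^ e))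
    refine ⟨G, ?_⟩
    rw [← hG, redeiAt_prod, ← Finset.prod_pow]
    refine Finset.prod_congr rfl fun c _ => ?_
    rw [← pow_mul, Nat.div_mul_cancel (hs2 c)]
  obtain ⟨K, hK⟩ : ∃ K, QAt U y = expand F (p ^ e) (expand F p K) := by
    refine ⟨contract (p * p ^ e) (QAt U y), ?_⟩
    rw [expand_expand]
    have hpos : 0 < p * p ^ e := Nat.mul_pos hp.pos (pow_pos hp.pos e)
    ext i
    rw [mul_comm, coeff_expand hpos]
    split_ifs with hd
    · rw [coeff_contract hpos.ne', Nat.div_mul_cancel hd]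
    · by_contra hne
      exact hd (hQ i hne)
  have hmon := redeiAt_monic U y
  have hdeg := redeiAt_natDegree U y
  have hcardlt : 1 < Fintype.card F := by omega
  have hdegX : (X ^ Fintype.card F - X : F[X]).natDegree = Fintype.card F :=
    FiniteField.X_pow_card_sub_X_natDegree_eq F hcardlt
  have hQdeg : (QAt U y).natDegree = Fintype.card F - U.card := by
    rw [QAt_eq, natDegree_divByMonic _ hmon, hdeg, hdegX]
  have hHdeg : (redeiAt U y * QAt U y - X ^ Fintype.card F).degree < (redeiAt U y).degree := by
    have h1 := modByMonic_add_div (X ^ Fintype.card F - X : F[X]) (redeiAt U y)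
    have h3 : redeiAt U y * QAt U y - X ^ Fintype.card F =
        - (X + (X ^ Fintype.card F - X) %ₘ redeiAt U y) := by
      rw [QAt_eq]; linear_combination h1
    rw [h3, degree_neg]
    refine lt_of_le_of_lt (degree_add_le _ _) (max_lt ?_ (degree_modByMonic_lt _ hmon))
    rw [degree_X, degree_eq_natDegree hmon.ne_zero, hdeg]
    exact_mod_cast h2
  have hspos : 0 < p ^ e := pow_pos hp.pos e
  have hexp : redeiAt U y * QAt U y - X ^ Fintype.card F =
      expand F (p ^ e) (G * expand F p K - (X ^ p ^ (h - e - 1)) ^ p) := by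
    rw [hG, hK, map_sub, map_mul, map_pow, map_pow, expand_X, ← pow_mul, ← pow_mul, hcard,
      ← pow_succ, ← pow_add]
    congr 3
    omega
  set L := G * expand F p K - (X ^ p ^ (h - e - 1)) ^ p with hL
  have hder : derivative L = derivative G * expand F p K := by
    rw [hL]
    simp [derivative_expand, derivative_pow]
  have hG0 : G ≠ 0 := by rintro rfl; exact hmon.ne_zero (by simpa using hG)
  have hGd : G.natDegree * p ^ e = U.card := by rw [← hdeg, hG, natDegree_expand]
  have hKd : (expand F p K).natDegree * p ^ e = Fintype.card F - U.card := by
    rw [← hQdeg, hK, natDegree_expand (p ^ e)]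
  have hLd : L.natDegree < G.natDegree := by
    have hlt : (expand F (p ^ e) L).natDegree < (redeiAt U y).natDegree := by
      rw [← hexp]
      by_cases h0 : redeiAt U y * QAt U y - X ^ Fintype.card F = 0
      · rw [h0, natDegree_zero]; omega
      · exact natDegree_lt_natDegree h0 hHdeg
    rw [hG, natDegree_expand, natDegree_expand] at hlt
    exact lt_of_mul_lt_mul_right hlt (Nat.zero_le _)
  have hGK : G.natDegree ≤ (expand F p K).natDegree := by
    refine le_of_mul_le_mul_right ?_ hspos
    omega
  have hdG : derivative G = 0 := by
    by_contra hne
    have hK0 : expand F p K ≠ 0 := by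
      intro h0
      rw [h0, natDegree_zero] at hGK
      omega
    have := natDegree_mul hne hK0
    rw [← hder] at this
    have := natDegree_derivative_le L
    omega
  intro c
  obtain ⟨T, hT⟩ := aux_pow p (e + 1) (contract p G)
  rw [← redeiAt_rootMult, hG, ← expand_contract p hdG hp.ne_zero, expand_expand, ← pow_succ, hT,
    ← count_roots, roots_pow, Multiset.count_nsmul]
  exact dvd_mul_right _ _
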